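/- Let C be symmetric positive definite with factorization C = C^{1/2}(C^{1/2})ᵀ. The gradient of φ(X) = tr(S log S - S), where S = C^{-1/2}·X·C^{-T/2}, at a symmetric positive definite matrix X is ∇φ(X) = C⁻¹·(C^{1/2}·log(C^{-1/2}·X·C^{-T/2})·C^{T/2})·C⁻¹, i.e., ∇φ(X) = C⁻¹·exp⁻¹_C(X)·C⁻¹ where exp⁻¹_C denotes the logarithmic map of the affine-invariant metric on the SPD manifold at base point C. -/

import Mathlib

open Matrix

/-- Matrix logarithm, defined via the continuous functional calculus (for self-adjoint
matrices; junk value otherwise). -/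
noncomputable def matLog {n : ℕ} (A : Matrix (Fin n) (Fin n) ℝ) : Matrix (Fin n) (Fin n) ℝ :=
  cfc Real.log A

namespace Matrix

/-- Squared overlaps of the eigenvectors of two Hermitian matrices express the trace of a product
of functions of these matrices as a double sum over eigenvalues, with nonnegative weights. -/
lemma exists_trace_cfc_mul_cfc_eq_sum {n : ℕ} {A B : Matrix (Fin n) (Fin n) ℝ}
    (hA : A.IsHermitian) (hB : B.IsHermitian) :
    ∃ w : Fin n → Fin n → ℝ, (∀ i j, 0 ≤ w i j) ∧ ∀ p q : ℝ → ℝ,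
      (cfc p B * cfc q A).trace =
        ∑ i, ∑ j, w i j * (p (hB.eigenvalues i) * q (hA.eigenvalues j)) := by
  set U : Matrix (Fin n) (Fin n) ℝ := hA.eigenvectorUnitary.1 with hU
  set V : Matrix (Fin n) (Fin n) ℝ := hB.eigenvectorUnitary.1 with hV
  refine ⟨fun i j => ((star V * U) i j) ^ 2, fun i j => sq_nonneg _, fun p q => ?_⟩
  rw [hA.cfc_eq, hB.cfc_eq, IsHermitian.cfc, IsHermitian.cfc, Unitary.conjStarAlgAut_apply,
    Unitary.conjStarAlgAut_apply, ← hU, ← hV]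
  have hW : star (star V * U) = star U * V := by simp
  have htr : ∀ D E : Matrix (Fin n) (Fin n) ℝ, (V * D * star V * (U * E * star U)).trace =
      (D * (star V * U) * (E * star (star V * U))).trace := fun D E => by
    rw [hW, mul_assoc, mul_assoc, trace_mul_comm]
    simp only [mul_assoc]
  refine (htr _ _).trans ?_
  rw [trace]
  refine Finset.sum_congr rfl fun i _ => ?_
  rw [diag_apply, mul_apply]
  refine Finset.sum_congr rfl fun j _ => ?_
  simp only [diagonal_mul, star_apply, star_trivial, Function.comp_apply, RCLike.ofReal_real_eq_id,
    id_eq]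
  ring

/-- A trace inequality between functions of two positive definite matrices follows from the corresponding
scalar inequality. -/
lemma sum_trace_cfc_mul_cfc_nonneg {n : ℕ} {ι : Type*} (s : Finset ι)
    {A B : Matrix (Fin n) (Fin n) ℝ} (hA : A.PosDef) (hB : B.PosDef) (p q : ι → ℝ → ℝ)
    (h : ∀ x y : ℝ, 0 < x → 0 < y → 0 ≤ ∑ k ∈ s, p k x * q k y) :
    0 ≤ ∑ k ∈ s, (cfc (p k) B * cfc (q k) A).trace := by
  obtain ⟨w, hw, hsum⟩ := exists_trace_cfc_mul_cfc_eq_sum hA.1 hB.1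
  simp only [hsum]
  rw [Finset.sum_comm]
  refine Finset.sum_nonneg fun i _ => ?_
  rw [Finset.sum_comm]
  refine Finset.sum_nonneg fun j _ => ?_
  rw [← Finset.mul_sum]
  exact mul_nonneg (hw i j) (h _ _ (hB.eigenvalues_pos i) (hA.eigenvalues_pos j))

/-- Positive definiteness is stable under small Hermitian perturbations. -/
lemma PosDef.eventually_add_smul {n : ℕ} {A B : Matrix (Fin n) (Fin n) ℝ}
    (hA : A.PosDef) (hB : B.IsHermitian) :
    ∀ᶠ t : ℝ in nhds 0, (A + t • B).PosDef := by
  have hlow : ∀ {M : Matrix (Fin n) (Fin n) ℝ} (hM : M.IsHermitian) (c : ℝ),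
      (∀ i, c ≤ hM.eigenvalues i) → (M - c • 1).PosSemidef := fun {M} hM c hc => by
    open scoped MatrixOrder in
    rw [← Matrix.le_iff, ← Algebra.algebraMap_eq_smul_one,
      algebraMap_le_iff_le_spectrum (ha := hM)]
    rw [hM.spectrum_real_eq_range_eigenvalues]
    rintro _ ⟨i, rfl⟩
    exact hc i
  obtain ⟨l, hl, hlA⟩ : ∃ l : ℝ, 0 < l ∧ (A - l • 1).PosSemidef := by
    obtain ⟨l, hl, h⟩ : ∃ l : ℝ, 0 < l ∧ ∀ i, l ≤ hA.1.eigenvalues i := by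
      rcases isEmpty_or_nonempty (Fin n) with _ | _
      · exact ⟨1, one_pos, fun i => isEmptyElim i⟩
      · obtain ⟨i, hi⟩ := Finite.exists_min hA.1.eigenvalues
        exact ⟨_, hA.eigenvalues_pos i, hi⟩
    exact ⟨l, hl, hlow _ _ h⟩
  have hbd : ∀ {M : Matrix (Fin n) (Fin n) ℝ}, M.IsHermitian →
      ∃ K : ℝ, ∀ k, K ≤ k → (M + k • 1).PosSemidef := fun {M} hM => by
    obtain ⟨K, hK⟩ := (Set.finite_range fun i => - hM.eigenvalues i).bddAbove
    refine ⟨K, fun k hk => ?_⟩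
    have := hlow hM (-k) fun i => by
      have := hK ⟨i, rfl⟩
      simp only at this
      linarith
    simpa using this
  obtain ⟨K₁, hK₁⟩ := hbd hB
  obtain ⟨K₂, hK₂⟩ := hbd hB.neg
  set K := max K₁ K₂
  have hsmall : ∀ᶠ t : ℝ in nhds 0, |t| * K < l := by
    have : Filter.Tendsto (fun t : ℝ => |t| * K) (nhds 0) (nhds (|0| * K)) :=
      (by fun_prop : Continuous fun t : ℝ => |t| * K).tendsto 0
    exact this.eventually_lt_const (by simpa using hl)
  filter_upwards [hsmall] with t ht
  have hpsd : (t • B + (|t| * K) • (1 : Matrix (Fin n) (Fin n) ℝ)).PosSemidef := by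
    rcases le_total 0 t with h | h
    · simpa [smul_add, smul_smul, abs_of_nonneg h] using (hK₁ K (le_max_left _ _)).smul h
    · simpa [smul_add, smul_smul, abs_of_nonpos h] using
        (hK₂ K (le_max_right _ _)).smul (neg_nonneg.2 h)
  have hpos : ((l - |t| * K) • (1 : Matrix (Fin n) (Fin n) ℝ)).PosDef :=
    PosDef.one.smul (sub_pos.2 ht)
  convert PosDef.posSemidef_add (hlA.add hpsd) hpos using 1
  module

lemma cfc_mul_eq {n : ℕ} (A : Matrix (Fin n) (Fin n) ℝ) (f g : ℝ → ℝ) :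
    cfc f A * cfc g A = cfc (fun x => f x * g x) A :=
  (cfc_mul f g A (A.finite_real_spectrum.continuousOn f)
    (A.finite_real_spectrum.continuousOn g)).symm

/-- The relative entropy of positive definite matrices is nonnegative (Klein inequality). -/
lemma PosDef.trace_relEntropy_nonneg {n : ℕ} {A B : Matrix (Fin n) (Fin n) ℝ}
    (hA : A.PosDef) (hB : B.PosDef) :
    0 ≤ (B * matLog B).trace - (B * matLog A).trace - B.trace + A.trace := by
  have h := sum_trace_cfc_mul_cfc_nonneg Finset.univ hA hB
    ![fun x => x * Real.log x, fun x => -x, fun x => -x, fun _ => 1]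
    ![fun _ => 1, Real.log, fun _ => 1, fun y => y] fun x y hx hy => by
      simp only [Fin.sum_univ_four, Matrix.cons_val]
      have h := Real.log_le_sub_one_of_pos (div_pos hy hx)
      rw [Real.log_div hy.ne' hx.ne'] at h
      have h' := mul_le_mul_of_nonneg_left h hx.le
      rw [mul_sub, mul_sub, mul_div_cancel₀ _ hx.ne'] at h'
      linarith
  have hA' : IsSelfAdjoint A := hA.1
  have hB' : IsSelfAdjoint B := hB.1
  simp only [Fin.sum_univ_four, Matrix.cons_val, ← cfc_mul_eq, cfc_id' ℝ A, cfc_id' ℝ B,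
    cfc_neg (fun x => x) B, cfc_const_one ℝ A, cfc_const_one ℝ B, mul_one, one_mul, neg_mul,
    trace_neg] at h
  simp only [matLog]
  linarith

/-- The relative entropy of positive definite matrices is bounded by the `χ²` divergence. -/
lemma PosDef.trace_relEntropy_le {n : ℕ} {A B : Matrix (Fin n) (Fin n) ℝ}
    (hA : A.PosDef) (hB : B.PosDef) :
    (B * matLog B).trace - (B * matLog A).trace - B.trace + A.trace ≤
      ((B - A) * (B - A) * A⁻¹).trace := by
  have h := sum_trace_cfc_mul_cfc_nonneg Finset.univ hA hB
    ![fun x => x * x, fun x => x, fun x => x * Real.log x, fun x => x]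
    ![fun y => y⁻¹, fun _ => -1, fun _ => -1, Real.log] fun x y hx hy => by
      simp only [Fin.sum_univ_four, Matrix.cons_val]
      have h := Real.log_le_sub_one_of_pos (div_pos hx hy)
      rw [Real.log_div hx.ne' hy.ne'] at h
      have h' := mul_le_mul_of_nonneg_left h hx.le
      rw [div_eq_mul_inv] at h'
      linarith
  have hA' : IsSelfAdjoint A := hA.1
  have hB' : IsSelfAdjoint B := hB.1
  have hinv : cfc (fun y : ℝ => y⁻¹) A = A⁻¹ := by
    symm
    apply inv_eq_left_inv
    nth_rewrite 2 [← cfc_id' ℝ A]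
    rw [cfc_mul_eq, ← cfc_const_one ℝ A]
    refine cfc_congr fun x hx => ?_
    rw [hA.1.spectrum_real_eq_range_eigenvalues] at hx
    obtain ⟨i, rfl⟩ := hx
    exact inv_mul_cancel₀ (hA.eigenvalues_pos i).ne'
  simp only [Fin.sum_univ_four, Matrix.cons_val, ← cfc_mul_eq, cfc_id' ℝ B, hinv,
    cfc_neg, cfc_const_one ℝ A, mul_one, mul_neg, trace_neg] at h
  have hdet : IsUnit A.det := (isUnit_iff_isUnit_det A).1 hA.isUnit
  have hexp : ((B - A) * (B - A) * A⁻¹).trace = (B * B * A⁻¹).trace - 2 * B.trace + A.trace := by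
    have : (A * B * A⁻¹).trace = B.trace := by
      rw [trace_mul_comm, ← mul_assoc, nonsing_inv_mul _ hdet, one_mul]
    simp only [sub_mul, mul_sub, trace_sub, mul_assoc, mul_nonsing_inv _ hdet, mul_one]
    simp only [← mul_assoc, this]
    ring
  rw [hexp]
  simp only [matLog]
  linarith

/-- Derivative of `t ↦ tr (A log A - A)` along a line of symmetric matrices. -/
theorem PosDef.hasDerivAt_trace_mul_matLog_sub {n : ℕ} {A B : Matrix (Fin n) (Fin n) ℝ}
    (hA : A.PosDef) (hB : B.IsHermitian) :
    HasDerivAt (fun t : ℝ => ((A + t • B) * matLog (A + t • B) - (A + t • B)).trace)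
      ((B * matLog A).trace) 0 := by
  rw [hasDerivAt_iff_isLittleO]
  have hO : (fun t : ℝ => ((A + t • B) * matLog (A + t • B) - (A + t • B)).trace -
      ((A + (0 : ℝ) • B) * matLog (A + (0 : ℝ) • B) - (A + (0 : ℝ) • B)).trace -
      (t - 0) • (B * matLog A).trace) =O[nhds 0] fun t : ℝ => t ^ 2 := by
    refine Asymptotics.IsBigO.of_bound ((B * B * A⁻¹).trace) ?_
    filter_upwards [hA.eventually_add_smul hB] with t ht
    have h₁ := hA.trace_relEntropy_nonneg ht
    have h₂ := hA.trace_relEntropy_le ht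
    have h₃ : ((A + t • B - A) * (A + t • B - A) * A⁻¹).trace = (B * B * A⁻¹).trace * t ^ 2 := by
      simp only [add_sub_cancel_left, Matrix.smul_mul, Matrix.mul_smul, trace_smul, smul_eq_mul]
      ring
    have h₄ : ((A + t • B) * matLog A).trace =
        (A * matLog A).trace + t * (B * matLog A).trace := by
      simp [add_mul]
    rw [h₄] at h₁ h₂
    rw [h₃] at h₂
    simp only [zero_smul, add_zero, sub_zero, smul_eq_mul, trace_sub, Real.norm_eq_abs, abs_pow,
      sq_abs]
    rw [abs_of_nonneg (by linarith)]
    linarith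
  refine hO.trans_isLittleO ?_
  simpa using Asymptotics.isLittleO_pow_id one_lt_two

end Matrix

/-- The gradient (with respect to the Frobenius inner product, along symmetric directions)
of `φ(X) = tr(S log S - S)` with `S = C^{-1/2} X C^{-T/2}` at an SPD matrix `X` is
`G = C⁻¹ (C^{1/2} log(C^{-1/2} X C^{-T/2}) C^{T/2}) C⁻¹ = C⁻¹ exp⁻¹_C(X) C⁻¹`:
for every symmetric direction `H`, the directional derivative of `φ` at `X` along `H`
equals `⟨G, H⟩ = tr(Gᵀ H)`. -/
theorem stmt_18 {n : ℕ} (C R X : Matrix (Fin n) (Fin n) ℝ)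
    (hC : C.PosDef) (hCR : C = R * Rᵀ) (hR : IsUnit R.det) (hX : X.PosDef) :
    ∀ (φ : Matrix (Fin n) (Fin n) ℝ → ℝ),
      (φ = fun Y =>
        ((R⁻¹ * Y * (Rᵀ)⁻¹) * matLog (R⁻¹ * Y * (Rᵀ)⁻¹) - R⁻¹ * Y * (Rᵀ)⁻¹).trace) →
    ∀ (G : Matrix (Fin n) (Fin n) ℝ),
      (G = C⁻¹ * (R * matLog (R⁻¹ * X * (Rᵀ)⁻¹) * Rᵀ) * C⁻¹) →
    ∀ H : Matrix (Fin n) (Fin n) ℝ, H.IsSymm →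
      HasDerivAt (fun t : ℝ => φ (X + t • H)) ((Gᵀ * H).trace) 0 := by
  rintro φ rfl G rfl H hH
  have hRT : IsUnit Rᵀ.det := by rwa [det_transpose]
  have hRi : (R⁻¹)ᵀ = (Rᵀ)⁻¹ := transpose_nonsing_inv R
  have hS : (R⁻¹ * X * (Rᵀ)⁻¹).PosDef := by
    have hu : IsUnit R⁻¹ := (isUnit_iff_isUnit_det _).2 (isUnit_nonsing_inv_det R hR)
    have := (Matrix.IsUnit.posDef_star_right_conjugate_iff (x := X) hu).2 hX
    rwa [star_eq_conjTranspose, conjTranspose_eq_transpose_of_trivial, hRi] at this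
  have hB : (R⁻¹ * H * (Rᵀ)⁻¹).IsHermitian := by
    rw [IsHermitian, conjTranspose_eq_transpose_of_trivial, transpose_mul, transpose_mul, hH.eq,
      ← hRi, transpose_transpose, mul_assoc]
  have hL : (matLog (R⁻¹ * X * (Rᵀ)⁻¹))ᵀ = matLog (R⁻¹ * X * (Rᵀ)⁻¹) := by
    rw [← conjTranspose_eq_transpose_of_trivial]
    exact cfc_predicate (p := IsSelfAdjoint) Real.log (R⁻¹ * X * (Rᵀ)⁻¹)
  have hlin : ∀ t : ℝ, R⁻¹ * (X + t • H) * (Rᵀ)⁻¹ =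
      R⁻¹ * X * (Rᵀ)⁻¹ + t • (R⁻¹ * H * (Rᵀ)⁻¹) := fun t => by
    simp [mul_add, add_mul]
  simp only [hlin]
  convert hS.hasDerivAt_trace_mul_matLog_sub hB using 1
  have hG : C⁻¹ * (R * matLog (R⁻¹ * X * (Rᵀ)⁻¹) * Rᵀ) * C⁻¹ =
      (Rᵀ)⁻¹ * matLog (R⁻¹ * X * (Rᵀ)⁻¹) * R⁻¹ := by
    rw [hCR, Matrix.mul_inv_rev]
    calc _ = (Rᵀ)⁻¹ * (R⁻¹ * R) * matLog (R⁻¹ * X * (Rᵀ)⁻¹) * (Rᵀ * (Rᵀ)⁻¹) * R⁻¹ := by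
          simp only [mul_assoc]
      _ = _ := by rw [nonsing_inv_mul _ hR, mul_nonsing_inv _ hRT, mul_one, mul_one]
  rw [hG, transpose_mul, transpose_mul, hL, ← hRi, transpose_transpose, hRi,
    trace_mul_comm (R⁻¹ * H * (Rᵀ)⁻¹)]
  calc _ = ((Rᵀ)⁻¹ * (matLog (R⁻¹ * X * (Rᵀ)⁻¹) * R⁻¹ * H)).trace := by simp only [mul_assoc]
    _ = _ := by rw [trace_mul_comm]; simp only [mul_assoc]
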